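/- Let r ≥ 1, let l and s be integers with 0 ≤ s ≤ l−1 and l ≤ r, and let P ∈ ℤ[x_l, …, x_r, q] be any polynomial not involving x_1, …, x_{l−1}. Then (Σ_{i=0}^{s−1} q^i ∏_{j=0}^{i} x_{l−s+j}) · P ≈ (Σ_{i=0}^{min(s, l−s)−1} q^i ∏_{j=0}^{i} x_{l−1−2j}) · P. -/

import Mathlib

open PowerSeries

noncomputable section

/-- The product (coefficientwise) topology on `ℚ⟦X⟧`. -/
instance : TopologicalSpace ℚ⟦X⟧ :=
  inferInstanceAs (TopologicalSpace ((Unit →₀ ℕ) → ℚ))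

/-- `(q)_n = ∏_{i=1}^n (1 - q^i)` in `ℚ⟦X⟧`. -/
def qp (n : ℕ) : ℚ⟦X⟧ := ∏ i ∈ Finset.range n, (1 - X ^ (i + 1))

/-- `(-q)_n = ∏_{i=1}^n (1 + q^i)` in `ℚ⟦X⟧`. -/
def nqp (n : ℕ) : ℚ⟦X⟧ := ∏ i ∈ Finset.range n, (1 + X ^ (i + 1))

/-- The Gaussian binomial `[M, N]_q`, zero unless `M ≥ N`. -/
def qbinom (M N : ℕ) : ℚ⟦X⟧ :=
  if N ≤ M then qp M * ((qp N)⁻¹ * (qp (M - N))⁻¹) else 0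

/-- Weakly decreasing tuples `f 0 ≥ f 1 ≥ … ≥ f (r-1) ≥ 0`, encoded as
antitone functions `ℕ → ℕ` vanishing from index `r` on. -/
def DecTuple (r : ℕ) : Type :=
  {f : ℕ → ℕ // (∀ ⦃i j : ℕ⦄, i ≤ j → f j ≤ f i) ∧ ∀ i, r ≤ i → f i = 0}

/-- `(q)_λ = (q)_{λ_1-λ_2} ⋯ (q)_{λ_{r-1}-λ_r} (q)_{λ_r}` for a weakly
decreasing tuple `λ` (0-indexed). -/
def qpT (r : ℕ) (f : ℕ → ℕ) : ℚ⟦X⟧ := ∏ i ∈ Finset.range r, qp (f i - f (i + 1))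


/-- The variable `x_j` (1-indexed, `1 ≤ j ≤ r`) of `ℤ[x_1,…,x_r,q]`, with the
conventions `x_j = 0` for `j < 1` and `x_j = 1` for `j > r`. -/
def xv (r j : ℕ) : MvPolynomial (Fin (r + 1)) ℤ :=
  if h : 1 ≤ j ∧ j ≤ r then MvPolynomial.X ⟨j - 1, by omega⟩
  else if j = 0 then 0 else 1

/-- The variable `q` of `ℤ[x_1,…,x_r,q]`. -/
def qv (r : ℕ) : MvPolynomial (Fin (r + 1)) ℤ := MvPolynomial.X (Fin.last r)

/-- Evaluation of `P ∈ ℤ[x_1,…,x_r,q]` at `x_j = q^{λ_j}` and `q = X` in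
`ℚ⟦X⟧`; here `f` is the 0-indexed tuple `(λ_1, …, λ_r)`. -/
def pEval (r : ℕ) (f : ℕ → ℕ) (P : MvPolynomial (Fin (r + 1)) ℤ) : ℚ⟦X⟧ :=
  MvPolynomial.aeval
    (fun i : Fin (r + 1) => if (i : ℕ) < r then (X : ℚ⟦X⟧) ^ f i else X) P

/-- The relation `P ≈ Q`:
`Σ_{λ_1 ≥ … ≥ λ_r ≥ 0} q^{Σ (λ_i²+λ_i)/2}/(q)_λ · (P(q^{λ_1},…,q^{λ_r},q) - Q(q^{λ_1},…,q^{λ_r},q)) = 0`. -/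
def papprox (r : ℕ) (P Q : MvPolynomial (Fin (r + 1)) ℤ) : Prop :=
  ∑' f : DecTuple r,
    (X : ℚ⟦X⟧) ^ (∑ i ∈ Finset.range r, f.1 i * (f.1 i + 1) / 2) * (qpT r f.1)⁻¹ *
      (pEval r f.1 P - pEval r f.1 Q) = 0

instance : T2Space ℚ⟦X⟧ := inferInstanceAs (T2Space ((Unit →₀ ℕ) → ℚ))

instance : IsTopologicalAddGroup ℚ⟦X⟧ :=
  inferInstanceAs (IsTopologicalAddGroup ((Unit →₀ ℕ) → ℚ))

theorem PowerSeries.summable_of_coeff {ι : Type*} (g : ι → ℚ⟦X⟧)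
    (h : ∀ n, {i | coeff n (g i) ≠ 0}.Finite) : Summable g := by
  have key : ∀ m : Unit →₀ ℕ, Summable fun i => (g i : (Unit →₀ ℕ) → ℚ) m := by
    intro m
    refine summable_of_hasFiniteSupport ((h (m ())).subset fun i hi => ?_)
    have hm : m = Finsupp.single () (m ()) := by ext; simp
    have hi' : g i m ≠ 0 := hi
    rw [hm] at hi'
    exact hi'
  exact Pi.summable.2 key

/-- The exponent `Σ λ_i (λ_i + 1) / 2`. -/
def triSum (r : ℕ) (f : ℕ → ℕ) : ℕ := ∑ i ∈ Finset.range r, f i * (f i + 1) / 2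

/-- The weight `q^{Σ λ_i (λ_i + 1) / 2} / (q)_λ`. -/
def weight (r : ℕ) (f : ℕ → ℕ) : ℚ⟦X⟧ := X ^ triSum r f * (qpT r f)⁻¹

theorem le_triSum {r i : ℕ} (f : ℕ → ℕ) (hi : i < r) : f i ≤ triSum r f := by
  have h1 : f i ≤ f i * (f i + 1) / 2 := by
    rw [Nat.le_div_iff_mul_le two_pos]
    rcases Nat.eq_zero_or_pos (f i) with h | h
    · simp [h]
    · nlinarith
  exact h1.trans (Finset.single_le_sum (f := fun i => f i * (f i + 1) / 2)
    (fun _ _ => Nat.zero_le _) (Finset.mem_range.2 hi))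

theorem finite_triSum_le (r n : ℕ) : {f : DecTuple r | triSum r f.1 ≤ n}.Finite := by
  refine Set.Finite.of_finite_image (f := fun (f : DecTuple r) (i : Fin r) =>
    (⟨min (f.1 i) n, by omega⟩ : Fin (n + 1))) (Set.toFinite _) ?_
  intro f hf g hg hfg
  apply Subtype.ext
  funext i
  rcases lt_or_ge i r with hi | hi
  · have h := congrArg Fin.val (congrFun hfg ⟨i, hi⟩)
    have h1 := (le_triSum f.1 hi).trans hf
    have h2 := (le_triSum g.1 hi).trans hg
    simpa [h1, h2] using h
  · rw [f.2.2 i hi, g.2.2 i hi]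

theorem summable_weight_mul (r : ℕ) (g : DecTuple r → ℚ⟦X⟧) :
    Summable fun f : DecTuple r => weight r f.1 * g f := by
  refine PowerSeries.summable_of_coeff _ fun n => (finite_triSum_le r n).subset fun f hf => ?_
  by_contra hlt
  refine hf ?_
  rw [Set.mem_ofPred_eq] at hlt
  rw [weight, mul_assoc, coeff_X_pow_mul', if_neg hlt]

/-- The weighted sum of a function over all weakly decreasing tuples. -/
def wsum (r : ℕ) : (DecTuple r → ℚ⟦X⟧) →+ ℚ⟦X⟧ where
  toFun g := ∑' f : DecTuple r, weight r f.1 * g f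
  map_zero' := by simp
  map_add' g h := by
    rw [← (summable_weight_mul r g).tsum_add (summable_weight_mul r h)]
    simp [mul_add]

theorem constantCoeff_qp (n : ℕ) : constantCoeff (qp n) = 1 := by
  simp [qp, map_prod]

theorem qp_succ (n : ℕ) : qp (n + 1) = qp n * (1 - X ^ (n + 1)) := Finset.prod_range_succ _ _

theorem qpT_ne_zero (r : ℕ) (f : ℕ → ℕ) : constantCoeff (qpT r f) ≠ 0 := by
  simp [qpT, map_prod, constantCoeff_qp]

/-- The value `q^{λ_j}` of the variable `x_j`, equal to `0` for `j = 0`. -/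
def ev (f : ℕ → ℕ) (j : ℕ) : ℚ⟦X⟧ := if j = 0 then 0 else X ^ f (j - 1)

@[simp] theorem ev_zero (f : ℕ → ℕ) : ev f 0 = 0 := rfl

@[simp] theorem ev_succ (f : ℕ → ℕ) (j : ℕ) : ev f (j + 1) = X ^ f j := rfl

/-- The factor `1 - q^{λ_{i-1} - λ_i}`, with `λ_{-1} = ∞`. -/
def topFactor (f : ℕ → ℕ) : ℕ → ℚ⟦X⟧
  | 0 => 1
  | i + 1 => 1 - X ^ (f i - f (i + 1))

theorem qpT_update (r i : ℕ) (hi : i < r) (f : ℕ → ℕ) (hf : f (i + 1) ≤ f i)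
    (hf' : ∀ t, t + 1 = i → f i < f t) :
    qpT r f * (1 - X ^ (f i + 1 - f (i + 1))) =
      qpT r (Function.update f i (f i + 1)) * topFactor f i := by
  have hu : (1 - X ^ (f i + 1 - f (i + 1)) : ℚ⟦X⟧) =
      ∏ t ∈ Finset.range r, if t = i then (1 - X ^ (f i + 1 - f (i + 1))) else 1 := by
    rw [Finset.prod_ite_eq', if_pos (Finset.mem_range.2 hi)]
  have hv : topFactor f i = ∏ t ∈ Finset.range r, if t + 1 = i then topFactor f i else 1 := by
    cases i with
    | zero => simp [topFactor]
    | succ i =>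
      simp only [add_left_inj]
      rw [Finset.prod_ite_eq', if_pos (Finset.mem_range.2 (by omega))]
  rw [hu, hv, qpT, qpT, ← Finset.prod_mul_distrib, ← Finset.prod_mul_distrib]
  refine Finset.prod_congr rfl fun t _ => ?_
  by_cases h1 : t = i
  · subst h1
    rw [if_pos rfl, if_neg (by omega), Function.update_self,
      Function.update_of_ne (by omega), mul_one,
      show f t + 1 - f (t + 1) = (f t - f (t + 1)) + 1 by omega, qp_succ]
  · rw [if_neg h1, Function.update_of_ne h1, mul_one]
    by_cases h2 : t + 1 = i
    · have := hf' t h2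
      subst h2
      rw [if_pos rfl, Function.update_self, topFactor,
        show f t - f (t + 1) = (f t - (f (t + 1) + 1)) + 1 by omega, qp_succ]
    · rw [if_neg h2, Function.update_of_ne h2, mul_one]

theorem triSum_update (r i : ℕ) (hi : i < r) (f : ℕ → ℕ) :
    triSum r (Function.update f i (f i + 1)) = triSum r f + (f i + 1) := by
  have h : (f i + 1) = ∑ t ∈ Finset.range r, if t = i then f i + 1 else 0 := by
    rw [Finset.sum_ite_eq', if_pos (Finset.mem_range.2 hi)]
  conv_rhs => rw [h]
  rw [triSum, triSum, ← Finset.sum_add_distrib]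
  refine Finset.sum_congr rfl fun t _ => ?_
  by_cases h1 : t = i
  · subst h1
    rw [if_pos rfl, Function.update_self,
      show (f t + 1) * (f t + 1 + 1) = f t * (f t + 1) + (f t + 1) * 2 by ring,
      Nat.add_mul_div_right _ _ two_pos]
  · simp [h1]

theorem weight_update (r i : ℕ) (hi : i < r) (f : ℕ → ℕ) (hf : f (i + 1) ≤ f i)
    (hf' : ∀ t, t + 1 = i → f i < f t) :
    weight r (Function.update f i (f i + 1)) * (1 - X ^ (f i + 1 - f (i + 1))) =
      weight r f * (X ^ (f i + 1) * topFactor f i) := by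
  have h := qpT_update r i hi f hf hf'
  have h1 := PowerSeries.mul_inv_cancel _ (qpT_ne_zero r f)
  have h2 := PowerSeries.mul_inv_cancel _ (qpT_ne_zero r (Function.update f i (f i + 1)))
  rw [weight, weight, triSum_update r i hi, pow_add]
  linear_combination (X ^ triSum r f * X ^ (f i + 1) * (qpT r f)⁻¹ *
    (qpT r (Function.update f i (f i + 1)))⁻¹) * h
    - (X ^ triSum r f * X ^ (f i + 1) * (qpT r (Function.update f i (f i + 1)))⁻¹ *
      (1 - X ^ (f i + 1 - f (i + 1)))) * h1
    + (X ^ triSum r f * X ^ (f i + 1) * (qpT r f)⁻¹ * topFactor f i) * h2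

theorem DecTuple.succ_le {r : ℕ} (f : DecTuple r) (t : ℕ) : f.1 (t + 1) ≤ f.1 t :=
  f.2.1 (Nat.le_succ t)

/-- Adding a box to row `i` of a weakly decreasing tuple. -/
def DecTuple.addBox {r : ℕ} (f : DecTuple r) (i : ℕ) (hi : i < r)
    (h : ∀ t, t + 1 = i → f.1 i < f.1 t) : DecTuple r :=
  ⟨Function.update f.1 i (f.1 i + 1), by
    refine ⟨antitone_nat_of_succ_le fun t => ?_, fun t ht => ?_⟩
    · have h1 := f.succ_le t
      by_cases h2 : t = i
      · subst h2
        rw [Function.update_self, Function.update_of_ne (by omega)]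
        omega
      · rw [Function.update_of_ne h2]
        by_cases h3 : t + 1 = i
        · have := h t h3
          subst h3
          rw [Function.update_self]
          omega
        · rwa [Function.update_of_ne h3]
    · rw [Function.update_of_ne (by omega), f.2.2 t ht]⟩

/-- Removing a box from row `i` of a weakly decreasing tuple. -/
def DecTuple.removeBox {r : ℕ} (f : DecTuple r) (i : ℕ) (h : f.1 (i + 1) < f.1 i) :
    DecTuple r :=
  ⟨Function.update f.1 i (f.1 i - 1), by
    refine ⟨antitone_nat_of_succ_le fun t => ?_, fun t ht => ?_⟩
    · have h1 := f.succ_le t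
      by_cases h2 : t = i
      · subst h2
        rw [Function.update_self, Function.update_of_ne (by omega)]
        omega
      · rw [Function.update_of_ne h2]
        by_cases h3 : t + 1 = i
        · subst h3
          rw [Function.update_self]
          omega
        · rwa [Function.update_of_ne h3]
    · have h0 := f.2.2 t ht
      by_cases h2 : t = i
      · subst h2
        omega
      · rw [Function.update_of_ne h2, h0]⟩

theorem lt_of_topFactor_ne_zero {r i : ℕ} (f : DecTuple r) (h : topFactor f.1 i ≠ 0) :
    ∀ t, t + 1 = i → f.1 i < f.1 t := by
  rintro t rfl
  have h1 := f.succ_le t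
  refine lt_of_le_of_ne h1 fun h2 => h ?_
  simp [topFactor, h2]

/-- Summing over box additions in row `i`. -/
theorem wsum_addBox (r i : ℕ) (hi : i < r) (h : DecTuple r → ℚ⟦X⟧)
    (hh : ∀ f g : DecTuple r, (∀ t, t ≠ i → f.1 t = g.1 t) → h f = h g) :
    wsum r (fun f => (1 - X ^ (f.1 i - f.1 (i + 1))) * h f) =
      wsum r (fun f => X ^ (f.1 i + 1) * topFactor f.1 i * h f) := by
  have hlt : ∀ f : DecTuple r, weight r f.1 * (X ^ (f.1 i + 1) * topFactor f.1 i * h f) ≠ 0 →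
      ∀ t, t + 1 = i → f.1 i < f.1 t := fun f hf =>
    lt_of_topFactor_ne_zero f fun h0 => hf (by simp [h0])
  refine tsum_eq_tsum_of_ne_zero_bij
    (fun f => f.1.addBox i hi (hlt f.1 f.2)) ?_ ?_ ?_
  · intro f g hfg
    apply Subtype.ext
    apply Subtype.ext
    funext t
    have := congrFun (congrArg Subtype.val hfg) t
    simp only [DecTuple.addBox] at this
    by_cases ht : t = i
    · subst ht
      simpa using this
    · simpa [ht] using this
  · intro f hf
    have hfi : f.1 (i + 1) < f.1 i := by
      refine lt_of_le_of_ne (f.succ_le i) fun h0 => hf ?_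
      simp [h0]
    have hup : Function.update (Function.update f.1 i (f.1 i - 1)) i (f.1 i - 1 + 1) = f.1 := by
      rw [Function.update_idem, Nat.sub_add_cancel (by omega), Function.update_eq_self]
    have hw := weight_update r i hi (f.removeBox i hfi).1 ((f.removeBox i hfi).succ_le i)
      (by
        rintro t rfl
        have := f.succ_le t
        simp only [DecTuple.removeBox, Function.update_self] at this ⊢
        rw [Function.update_of_ne (by omega)]
        omega)
    have hhf : h (f.removeBox i hfi) = h f := hh _ _ fun t ht => by
      simp [DecTuple.removeBox, ht]
    refine ⟨⟨f.removeBox i hfi, ?_⟩, ?_⟩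
    · rw [Function.mem_support, ← mul_assoc, ← hw, hhf]
      rw [Function.mem_support] at hf
      simp only [DecTuple.removeBox, Function.update_self, hup]
      rw [Function.update_of_ne (by omega), Nat.sub_add_cancel (by omega), mul_assoc]
      exact hf
    · apply Subtype.ext
      simp only [DecTuple.addBox, DecTuple.removeBox, Function.update_self]
      exact hup
  · rintro ⟨f, hf⟩
    have hw := weight_update r i hi f.1 (f.succ_le i) (hlt f hf)
    have hhf : h (f.addBox i hi (hlt f hf)) = h f := hh _ _ fun t ht => by
      simp [DecTuple.addBox, ht]
    simp only [hhf]
    rw [← mul_assoc, ← mul_assoc, ← hw]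
    simp [DecTuple.addBox]

/-- The basic relation `x_j (1 + q x_{j+1}) ≈ x_{j+1} (1 + q x_{j-1})`, with any multiplier
not involving `x_j`. -/
theorem wsum_basic (r i : ℕ) (hi : i < r) (h : DecTuple r → ℚ⟦X⟧)
    (hh : ∀ f g : DecTuple r, (∀ t, t ≠ i → f.1 t = g.1 t) → h f = h g) :
    wsum r (fun f => ev f.1 (i + 1) * (1 + X * ev f.1 (i + 2)) * h f) =
      wsum r (fun f => ev f.1 (i + 2) * (1 + X * ev f.1 i) * h f) := by
  have key := wsum_addBox r i hi (fun f => ev f.1 (i + 2) * h f) fun f g hfg => by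
    simp only [ev_succ]
    rw [hfg (i + 1) (by omega), hh f g hfg]
  rw [← sub_eq_zero, ← map_sub] at key ⊢
  rw [← neg_eq_zero, ← map_neg] at key
  rw [← key]
  congr 1
  funext f
  simp only [Pi.sub_apply, Pi.neg_apply, ev_succ]
  have h1 : (X : ℚ⟦X⟧) ^ (f.1 i - f.1 (i + 1)) * X ^ f.1 (i + 1) = X ^ f.1 i := by
    rw [← pow_add, Nat.sub_add_cancel (f.succ_le i)]
  have h2 : (X : ℚ⟦X⟧) ^ f.1 i * topFactor f.1 i = X ^ f.1 i - ev f.1 i := by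
    cases i with
    | zero => simp [topFactor]
    | succ i =>
      rw [topFactor, mul_sub, ← pow_add, Nat.add_sub_cancel' (f.succ_le i), mul_one,
        ev_succ]
  linear_combination (-h f) * h1 - (X * X ^ f.1 (i + 1) * h f) * h2

/-- The function `h` depends only on the coordinates with (0-based) index at least `k`. -/
def TailFun {r : ℕ} (k : ℕ) (h : DecTuple r → ℚ⟦X⟧) : Prop :=
  ∀ f g : DecTuple r, (∀ t, k ≤ t → f.1 t = g.1 t) → h f = h g

theorem TailFun.mono {r k k' : ℕ} {h : DecTuple r → ℚ⟦X⟧} (hh : TailFun k h) (hk : k' ≤ k) :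
    TailFun k' h := fun f g hfg => hh f g fun t ht => hfg t (hk.trans ht)

theorem TailFun.mul {r k : ℕ} {g h : DecTuple r → ℚ⟦X⟧} (hg : TailFun k g) (hh : TailFun k h) :
    TailFun k fun f => g f * h f := fun f f' hff => by
  simp only [hg f f' hff, hh f f' hff]

theorem TailFun.const {r k : ℕ} (c : ℚ⟦X⟧) : TailFun k fun _ : DecTuple r => c :=
  fun _ _ _ => rfl

theorem TailFun.ev {r k j : ℕ} (hj : k < j) : TailFun k fun f : DecTuple r => ev f.1 j :=
  fun f g hfg => by
    obtain ⟨j, rfl⟩ := Nat.exists_eq_succ_of_ne_zero (Nat.ne_zero_of_lt hj)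
    simp only [Nat.succ_eq_add_one, ev_succ, hfg j (by omega)]

/-- The product `x_k x_{k-2} ⋯` with `n` factors. -/
def stepProd (f : ℕ → ℕ) (k n : ℕ) : ℚ⟦X⟧ := ∏ j ∈ Finset.range n, ev f (k - 2 * j)

/-- The sum `Σ_{i<n} q^i x_k x_{k-2} ⋯ x_{k-2i}`. -/
def stepSum (f : ℕ → ℕ) (k n : ℕ) : ℚ⟦X⟧ :=
  ∑ i ∈ Finset.range n, X ^ i * stepProd f k (i + 1)

/-- The sum `Σ_{i<s} q^i x_a x_{a+1} ⋯ x_{a+i}`. -/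
def windowSum (f : ℕ → ℕ) (a s : ℕ) : ℚ⟦X⟧ :=
  ∑ i ∈ Finset.range s, X ^ i * ∏ j ∈ Finset.range (i + 1), ev f (a + j)

theorem stepProd_succ' (f : ℕ → ℕ) (k n : ℕ) :
    stepProd f (k + 2) (n + 1) = ev f (k + 2) * stepProd f k n := by
  rw [stepProd, Finset.prod_range_succ', mul_comm]
  congr 1
  refine Finset.prod_congr rfl fun j _ => ?_
  congr 1
  omega

theorem stepSum_succ' (f : ℕ → ℕ) (k n : ℕ) :
    stepSum f (k + 2) (n + 1) = ev f (k + 2) * (1 + X * stepSum f k n) := by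
  simp only [stepSum, stepProd_succ']
  rw [Finset.sum_range_succ', mul_add, Finset.mul_sum, Finset.mul_sum, add_comm]
  simp only [stepProd, Finset.prod_range_zero, pow_zero, one_mul, mul_one]
  congr 1
  refine Finset.sum_congr rfl fun i _ => ?_
  ring

theorem windowSum_succ_succ (f : ℕ → ℕ) (a s : ℕ) :
    windowSum f a (s + 2) = (1 + X * ev f (a + s + 1)) * windowSum f a (s + 1) -
      X * ev f (a + s + 1) * windowSum f a s := by
  simp only [windowSum, Finset.sum_range_succ, Finset.prod_range_succ, add_assoc]
  ring

theorem ev_congr {f g : ℕ → ℕ} {k j : ℕ} (hj : j ≤ k) (h : ∀ t, t < k → f t = g t) :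
    ev f j = ev g j := by
  cases j with
  | zero => rfl
  | succ j => rw [ev_succ, ev_succ, h j (by omega)]

theorem stepProd_congr {f g : ℕ → ℕ} {k : ℕ} (n : ℕ) (h : ∀ t, t < k → f t = g t) :
    stepProd f k n = stepProd g k n :=
  Finset.prod_congr rfl fun _ _ => ev_congr (Nat.sub_le _ _) h

/-- `(1 + q x_k) x_{k-1} x_{k-3} ⋯ ≈ x_k x_{k-2} ⋯ (1 + q x_{k-2n})` (with `n` factors in each
product), with any multiplier not involving `x_1, …, x_{k-1}`. -/
theorem wsum_stepProd (r n : ℕ) : ∀ (k : ℕ) (h : DecTuple r → ℚ⟦X⟧), k < r → 2 * n ≤ k + 2 →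
    TailFun (k + 1) h →
    wsum r (fun f => (1 + X * ev f.1 (k + 2)) * stepProd f.1 (k + 1) n * h f) =
      wsum r (fun f => stepProd f.1 (k + 2) n * (1 + X * ev f.1 (k + 2 - 2 * n)) * h f) := by
  induction n with
  | zero => intro k h _ _ _; simp [stepProd]
  | succ n ih =>
    intro k h hk hn hh
    cases n with
    | zero =>
      have := wsum_basic r k hk h fun f g hfg => hh f g fun t ht => hfg t (by omega)
      simp only [stepProd, zero_add, Finset.prod_range_one, mul_zero, mul_one, Nat.sub_zero,
        Nat.add_sub_cancel]
      rw [← this]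
      congr 1
      funext f
      ring
    | succ n =>
      obtain ⟨k, rfl⟩ : ∃ k', k = k' + 2 := ⟨k - 2, by omega⟩
      have h1 := wsum_basic r (k + 2) hk (fun f => stepProd f.1 (k + 1) (n + 1) * h f)
        fun f g hfg => by
          rw [hh f g fun t ht => hfg t (by omega),
            stepProd_congr (n + 1) fun t (ht : t < k + 1) => hfg t (by omega)]
      have h2 := ih k (fun f => ev f.1 (k + 4) * h f) (by omega) (by omega)
        ((TailFun.ev (by omega)).mul (hh.mono (by omega)))
      have e1 : ∀ f : DecTuple r, (1 + X * ev f.1 (k + 2 + 2)) *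
          stepProd f.1 (k + 2 + 1) (n + 1 + 1) * h f =
          ev f.1 (k + 2 + 1) * (1 + X * ev f.1 (k + 2 + 2)) *
            (stepProd f.1 (k + 1) (n + 1) * h f) := fun f => by
        rw [show k + 2 + 1 = k + 1 + 2 by omega, stepProd_succ']
        ring
      have e2 : ∀ f : DecTuple r, ev f.1 (k + 2 + 2) * (1 + X * ev f.1 (k + 2)) *
            (stepProd f.1 (k + 1) (n + 1) * h f) =
          (1 + X * ev f.1 (k + 2)) * stepProd f.1 (k + 1) (n + 1) *
            (ev f.1 (k + 4) * h f) := fun f => by ring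
      have e3 : ∀ f : DecTuple r, stepProd f.1 (k + 2 + 2) (n + 1 + 1) *
          (1 + X * ev f.1 (k + 2 + 2 - 2 * (n + 1 + 1))) * h f =
          stepProd f.1 (k + 2) (n + 1) * (1 + X * ev f.1 (k + 2 - 2 * (n + 1))) *
            (ev f.1 (k + 4) * h f) := fun f => by
        rw [stepProd_succ', show k + 2 + 2 - 2 * (n + 1 + 1) = k + 2 - 2 * (n + 1) by omega]
        ring
      simp only [e1, h1, e2, h2, e3]

/-- `(1 + q x_k) Σ_{i<n} q^i x_{k-1} x_{k-3} ⋯ x_{k-1-2i} + x_k` is equivalent to the sum of the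
two consecutive partial sums of `Σ q^i x_k x_{k-2} ⋯ x_{k-2i}` with `n + 1` and `n` terms. -/
theorem wsum_stepSum (r k n : ℕ) (h : DecTuple r → ℚ⟦X⟧) (hk : k < r) (hn : 2 * n ≤ k + 2)
    (hh : TailFun (k + 1) h) :
    wsum r (fun f => (1 + X * ev f.1 (k + 2)) * stepSum f.1 (k + 1) n * h f)
        + wsum r (fun f => ev f.1 (k + 2) * h f) =
      wsum r (fun f => stepSum f.1 (k + 2) (n + 1) * h f)
        + wsum r (fun f => stepSum f.1 (k + 2) n * h f) := by
  induction n with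
  | zero => simp [stepSum, stepProd, ← map_add, Pi.add_def]
  | succ n ih =>
    have h1 := ih (by omega)
    have h2 := wsum_stepProd r (n + 1) k (fun f => X ^ n * h f) hk hn ((TailFun.const _).mul hh)
    have h3 := congrArg₂ (· + ·) h1 h2
    simp only [← map_add] at h3 ⊢
    convert h3 using 2
    · funext f
      simp only [Pi.add_apply, stepSum, Finset.sum_range_succ]
      ring
    · funext f
      have e : stepProd f.1 (k + 2) (n + 1 + 1) =
          stepProd f.1 (k + 2) (n + 1) * ev f.1 (k + 2 - 2 * (n + 1)) :=
        Finset.prod_range_succ _ _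
      simp only [Pi.add_apply, stepSum, Finset.sum_range_succ, e]
      ring

theorem stepSum_vanish (f : ℕ → ℕ) (n : ℕ) : stepSum f (2 * n) (n + 1) = stepSum f (2 * n) n := by
  rw [stepSum, Finset.sum_range_succ, ← stepSum, stepProd, Finset.prod_range_succ]
  simp

/-- The sum over windows starting at `x_a` and ending at most at `x_{a+s-1}` is equivalent to
the sum over steps of size two going down from `x_{a+s-1}`. -/
theorem wsum_windowSum (r s : ℕ) : ∀ (a k : ℕ) (h : DecTuple r → ℚ⟦X⟧), 1 ≤ a → k + 1 = a + s →
    k ≤ r → TailFun k h →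
    wsum r (fun f => windowSum f.1 a s * h f) =
      wsum r (fun f => stepSum f.1 k (min s a) * h f) := by
  induction s using Nat.twoStepInduction with
  | zero => intro a k h _ _ _ _; simp [windowSum, stepSum]
  | one =>
    intro a k h ha hk _ _
    obtain rfl : k = a := by omega
    simp [windowSum, stepSum, stepProd, ha]
  | more s ih0 ih1 =>
    intro a k h ha hk hr hh
    obtain ⟨k, rfl⟩ : ∃ k', k = k' + 2 := ⟨k - 2, by omega⟩
    have hev : TailFun (r := r) (k + 1) fun f => ev f.1 (k + 2) := TailFun.ev (by omega)
    have hh1 : TailFun (k + 1) h := hh.mono (by omega)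
    have h1 := ih1 a (k + 1) (fun f => h f + X * (ev f.1 (k + 2) * h f)) ha (by omega) (by omega)
      fun f g hfg => congrArg₂ (fun u v => u + X * (v * u)) (hh1 f g hfg) (hev f g hfg)
    have h0 := ih0 a k (fun f => X * (ev f.1 (k + 2) * h f)) ha (by omega) (by omega)
      (((TailFun.const _).mul (hev.mul hh1)).mono (by omega))
    have h2 := wsum_stepSum r k (min (s + 1) a) h (by omega) (by omega) hh1
    have hL : wsum r (fun f => windowSum f.1 a (s + 2) * h f) =
        wsum r (fun f => stepSum f.1 (k + 2) (min (s + 1) a + 1) * h f)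
        + wsum r (fun f => stepSum f.1 (k + 2) (min (s + 1) a) * h f)
        - wsum r (fun f => stepSum f.1 (k + 2) (min s a + 1) * h f) := by
      have e1 : wsum r (fun f => windowSum f.1 a (s + 2) * h f) =
          wsum r (fun f => windowSum f.1 a (s + 1) * (h f + X * (ev f.1 (k + 2) * h f)))
          - wsum r (fun f => windowSum f.1 a s * (X * (ev f.1 (k + 2) * h f))) := by
        rw [← map_sub]
        congr 1
        funext f
        rw [Pi.sub_apply, windowSum_succ_succ, show a + s + 1 = k + 2 by omega]
        ring
      have e2 : wsum r (fun f => stepSum f.1 (k + 2) (min s a + 1) * h f) =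
          wsum r (fun f => ev f.1 (k + 2) * h f) +
          wsum r (fun f => stepSum f.1 k (min s a) * (X * (ev f.1 (k + 2) * h f))) := by
        rw [← map_add]
        congr 1
        funext f
        rw [Pi.add_apply, stepSum_succ']
        ring
      have e3 : wsum r (fun f => stepSum f.1 (k + 1) (min (s + 1) a) *
            (h f + X * (ev f.1 (k + 2) * h f))) =
          wsum r (fun f => (1 + X * ev f.1 (k + 2)) * stepSum f.1 (k + 1) (min (s + 1) a) *
            h f) := by
        congr 1
        funext f
        ring
      rw [e1, e2, h1, h0, e3, ← h2]
      ring
    rw [hL]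
    rcases lt_trichotomy a (s + 1) with hlt | rfl | hlt
    · rw [min_eq_right (by omega), min_eq_right (by omega), min_eq_right (by omega)]
      ring
    · have hk2 : k + 2 = 2 * (s + 1) := by omega
      rw [min_self, min_eq_left (by omega), min_eq_right (by omega), hk2]
      simp only [stepSum_vanish]
      ring
    · rw [min_eq_left (by omega), min_eq_left (by omega), min_eq_left (by omega)]
      ring

theorem pEval_xv (r : ℕ) (f : DecTuple r) (j : ℕ) : pEval r f.1 (xv r j) = ev f.1 j := by
  cases j with
  | zero => simp [pEval, xv]
  | succ j =>
    by_cases h : j < r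
    · have h' : 1 ≤ j + 1 ∧ j + 1 ≤ r := by omega
      simp [pEval, xv, h', h]
    · have h' : ¬ (1 ≤ j + 1 ∧ j + 1 ≤ r) := by omega
      rw [xv, dif_neg h', if_neg (by omega), ev_succ, f.2.2 j (by omega)]
      simp [pEval]

theorem pEval_qv (r : ℕ) (f : ℕ → ℕ) : pEval r f (qv r) = X := by simp [pEval, qv]

theorem pEval_sum_mul (r n : ℕ) (f : DecTuple r) (P : MvPolynomial (Fin (r + 1)) ℤ)
    (a : ℕ → ℕ) :
    pEval r f.1 ((∑ i ∈ Finset.range n,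
      qv r ^ i * ∏ j ∈ Finset.range (i + 1), xv r (a j)) * P) =
    (∑ i ∈ Finset.range n, X ^ i * ∏ j ∈ Finset.range (i + 1), ev f.1 (a j)) *
      pEval r f.1 P := by
  have h1 := pEval_qv r f.1
  have h2 := pEval_xv r f
  simp only [pEval] at h1 h2 ⊢
  simp only [map_mul, map_sum, map_pow, map_prod, h1, h2]

theorem tailFun_pEval {r k : ℕ} (P : MvPolynomial (Fin (r + 1)) ℤ)
    (hP : ∀ j : Fin (r + 1), (j : ℕ) < k → j ∉ P.vars) :
    TailFun k fun f : DecTuple r => pEval r f.1 P := fun f g hfg =>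
  MvPolynomial.eval₂Hom_congr' rfl (fun i hi _ => by
    rw [hfg i (not_lt.1 fun h => hP i h hi)]) rfl

/-- `(Σ_{i=0}^{s-1} qⁱ ∏_{j=0}^{i} x_{l-s+j}) P ≈
(Σ_{i=0}^{min(s,l-s)-1} qⁱ ∏_{j=0}^{i} x_{l-1-2j}) P` for `P` not involving
`x_1, …, x_{l-1}`. -/
theorem stmt5 (r l s : ℕ) (hr : 1 ≤ r) (hs : s + 1 ≤ l) (hl : l ≤ r)
    (P : MvPolynomial (Fin (r + 1)) ℤ)
    (hP : ∀ j : Fin (r + 1), (j : ℕ) + 1 < l → j ∉ P.vars) :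
    papprox r
      ((∑ i ∈ Finset.range s,
          qv r ^ i * ∏ j ∈ Finset.range (i + 1), xv r (l - s + j)) * P)
      ((∑ i ∈ Finset.range (min s (l - s)),
          qv r ^ i * ∏ j ∈ Finset.range (i + 1), xv r (l - 1 - 2 * j)) * P) := by
  have key := wsum_windowSum r s (l - s) (l - 1) (fun f => pEval r f.1 P) (by omega) (by omega)
    (by omega) (tailFun_pEval P fun j hj => hP j (by omega))
  rw [← sub_eq_zero, ← map_sub] at key
  simp only [papprox, pEval_sum_mul]
  exact key
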